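/- arXiv:1311.2219 — 3 statements merged into one kernel-verified Lean document; each statement's English description precedes it below -/
import Mathlib

section
/- Let X be a finite set of cardinality n, and let R be an order on X with 𝓔_R = (𝓔_R)^op, so that E_R = Δ ∪ 𝓔_R is an equivalence relation on X; let r be the number of equivalence classes of E_R and suppose r < n. Then the poset ]R,·[ = {T ∈ Ω_X : R ⊂ T} has the homotopy type of a sphere of dimension n − r − 1: the geometric realization of its order complex is homotopy equivalent to the sphere S^{n−r−1}. -/
open scoped BigOperators ContinuousMap

variable {X : Type*}

/-- A relation `R ⊆ X × X` is an order: reflexive, transitive, antisymmetric. -/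
def IsOrder (R : Set (X × X)) : Prop :=
  (∀ x : X, (x, x) ∈ R) ∧
  (∀ x y z : X, (x, y) ∈ R → (y, z) ∈ R → (x, z) ∈ R) ∧
  (∀ x y : X, (x, y) ∈ R → (y, x) ∈ R → x = y)

/-- The opposite relation. -/
def opRel (R : Set (X × X)) : Set (X × X) := {p | (p.2, p.1) ∈ R}

/-- The equality relation `Δ` on `X`. -/
def delta (X : Type*) : Set (X × X) := {p | p.1 = p.2}

/-- `(x, y)` is an adjacent pair for `S` : `x <_S y` and `]x, y[_S = ∅`. -/
def Adjacent (S : Set (X × X)) (x y : X) : Prop :=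
  (x, y) ∈ S ∧ x ≠ y ∧ ∀ z : X, (x, z) ∈ S → x ≠ z → (z, y) ∈ S → z ≠ y → False

/-- The order `R` is maximal in the order `S`. -/
def IsMaximalIn (R S : Set (X × X)) : Prop :=
  IsOrder R ∧ R ⊂ S ∧ ∀ T : Set (X × X), IsOrder T → R ⊂ T → ¬ T ⊂ S

/-- The order `R^(2)` on `X × X` : `(x,y) ≤ (x',y')` iff `x ≤_R x'` and `y' ≤_R y`. -/
def le2 (R : Set (X × X)) (p q : X × X) : Prop := (p.1, q.1) ∈ R ∧ (q.2, p.2) ∈ R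

/-- `p` is a minimal element of `(X × X) − (R ∪ R^op)` for the relation `R^(2)`. -/
def MinimalPair (R : Set (X × X)) (p : X × X) : Prop :=
  p ∉ R ∪ opRel R ∧ ∀ q : X × X, q ∉ R ∪ opRel R → le2 R q p → q = p

/-- The Frattini subrelation of `S` : the intersection (inside `S`) of all
maximal order subrelations of `S`. -/
def frattiniRel (S : Set (X × X)) : Set (X × X) :=
  {p ∈ S | ∀ R : Set (X × X), IsMaximalIn R S → p ∈ R}

/-- Composition of relations. -/
def composeRel (R S : Set (X × X)) : Set (X × X) := {p | ∃ z : X, (p.1, z) ∈ R ∧ (z, p.2) ∈ S}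

/-- The transitive closure of a relation: the smallest transitive relation containing it. -/
def transClosure (U : Set (X × X)) : Set (X × X) :=
  {p | Relation.TransGen (fun a b => (a, b) ∈ U) p.1 p.2}

/-- `]·, x[_R`. -/
def lowerSet (R : Set (X × X)) (x : X) : Set X := {z | (z, x) ∈ R ∧ z ≠ x}

/-- `]x, ·[_R`. -/
def upperSet (R : Set (X × X)) (x : X) : Set X := {z | (x, z) ∈ R ∧ x ≠ z}

/-- The set `𝓔_R`. -/
def eSet (R : Set (X × X)) : Set (X × X) :=
  {p | p ∉ R ∪ opRel R ∧ lowerSet R p.1 ⊆ lowerSet R p.2 ∧ upperSet R p.2 ⊆ upperSet R p.1}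

/-- The geometric realization of the order complex (nerve) of a poset `P`:
convex combinations of elements of `P` whose support is a chain. -/
def orderComplex (P : Type*) [PartialOrder P] : Set (P → ℝ) :=
  {f | (∀ p, 0 ≤ f p) ∧ (∑ᶠ p, f p) = 1 ∧ IsChain (· ≤ ·) {p | f p ≠ 0}}

section SegmentHomotopy

/-- Two maps into a subset of a real topological vector space are homotopic when the segments
joining their values stay in the subset. -/
lemma ContinuousMap.homotopic_of_segment {A E : Type*} [TopologicalSpace A] [AddCommGroup E]
    [Module ℝ E] [TopologicalSpace E] [IsTopologicalAddGroup E] [ContinuousSMul ℝ E] {S : Set E}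
    (f g : C(A, S))
    (h : ∀ a, ∀ t : ℝ, 0 ≤ t → t ≤ 1 → (1 - t) • (f a : E) + t • (g a : E) ∈ S) :
    f.Homotopic g :=
  ⟨{ toFun := fun q => ⟨(1 - (q.1 : ℝ)) • (f q.2 : E) + (q.1 : ℝ) • (g q.2 : E),
        h q.2 q.1 q.1.2.1 q.1.2.2⟩
     continuous_toFun := by fun_prop
     map_zero_left := fun a => by simp
     map_one_left := fun a => by simp }⟩

end SegmentHomotopy

section OrderComplex

variable {P : Type*} [PartialOrder P]

lemma mem_orderComplex_iff [Fintype P] {f : P → ℝ} :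
    f ∈ orderComplex P ↔ (∀ p, 0 ≤ f p) ∧ ∑ p, f p = 1 ∧ IsChain (· ≤ ·) {p | f p ≠ 0} := by
  simp only [orderComplex, Set.mem_ofPred_eq, finsum_eq_sum_of_fintype]

/-- A continuous family of nonzero nonnegative weights supported on chains, normalized to a
map into the order complex. -/
noncomputable def orderComplexOfWeights [Fintype P] {A : Type*} [TopologicalSpace A]
    (ψ : A → P → ℝ) (hc : Continuous ψ) (h0 : ∀ a p, 0 ≤ ψ a p) (h1 : ∀ a, ∃ p, 0 < ψ a p)
    (hch : ∀ a, IsChain (· ≤ ·) {p | 0 < ψ a p}) : C(A, orderComplex P) where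
  toFun a := ⟨fun p => ψ a p / ∑ q, ψ a q, by
    have hs : 0 < ∑ q, ψ a q := by
      obtain ⟨p, hp⟩ := h1 a
      exact Finset.sum_pos' (fun q _ => h0 a q) ⟨p, Finset.mem_univ _, hp⟩
    refine mem_orderComplex_iff.2 ⟨fun p => div_nonneg (h0 a p) hs.le, ?_, ?_⟩
    · rw [← Finset.sum_div, div_self hs.ne']
    · refine (hch a).mono fun p hp => ?_
      refine lt_of_le_of_ne (h0 a p) fun h => hp ?_
      simp [← h]⟩
  continuous_toFun := by
    refine Continuous.subtype_mk (continuous_pi fun p => ?_) _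
    refine Continuous.div (by fun_prop) (by fun_prop) fun a => ?_
    obtain ⟨p, hp⟩ := h1 a
    exact (Finset.sum_pos' (fun q _ => h0 a q) ⟨p, Finset.mem_univ _, hp⟩).ne'

lemma pos_of_orderComplexOfWeights_ne_zero [Fintype P] {A : Type*} [TopologicalSpace A]
    {ψ : A → P → ℝ} {hc : Continuous ψ} {h0 : ∀ a p, 0 ≤ ψ a p} {h1 : ∀ a, ∃ p, 0 < ψ a p}
    {hch : ∀ a, IsChain (· ≤ ·) {p | 0 < ψ a p}} {a : A} {p : P}
    (h : (orderComplexOfWeights ψ hc h0 h1 hch a : P → ℝ) p ≠ 0) : 0 < ψ a p := by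
  refine lt_of_le_of_ne (h0 a p) fun hz => h ?_
  simp [orderComplexOfWeights, ← hz]

/-- Two points of the order complex whose supports lie in a common chain are joined by a
segment. -/
lemma segment_mem_orderComplex [Fintype P] {f g : P → ℝ} (hf : f ∈ orderComplex P)
    (hg : g ∈ orderComplex P) (hch : IsChain (· ≤ ·) {p | f p ≠ 0 ∨ g p ≠ 0}) {t : ℝ}
    (h0 : 0 ≤ t) (h1 : t ≤ 1) : (1 - t) • f + t • g ∈ orderComplex P := by
  rw [mem_orderComplex_iff] at *
  refine ⟨fun p => ?_, ?_, hch.mono fun p hp => ?_⟩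
  · have := hf.1 p
    have := hg.1 p
    have : 0 ≤ 1 - t := by linarith
    simp only [Pi.add_apply, Pi.smul_apply, smul_eq_mul]
    positivity
  · simp [Finset.sum_add_distrib, ← Finset.mul_sum, hf.2.1, hg.2.1]
  · simp only [Set.mem_ofPred_eq]
    by_contra! h
    exact hp (by simp [h.1, h.2])

open Classical in
/-- The mass that `f` gives to the elements strictly below `p`. -/
noncomputable def massBelow [Fintype P] (f : P → ℝ) (p : P) : ℝ :=
  ∑ q with q < p, f q

lemma continuous_massBelow [Fintype P] (p : P) : Continuous fun f : P → ℝ => massBelow f p := by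
  unfold massBelow
  fun_prop

lemma exists_massBelow_eq_zero [Fintype P] {f : P → ℝ} (hf : f ∈ orderComplex P) :
    ∃ p, 0 < f p ∧ massBelow f p = 0 := by
  have hne : {p | f p ≠ 0}.Nonempty := by
    by_contra! h
    have h2 := (mem_orderComplex_iff.1 hf).2.1
    have h3 : ∀ p, f p = 0 := fun p => by
      by_contra hp
      exact (h ▸ hp : p ∈ (∅ : Set P))
    simp [h3] at h2
  obtain ⟨p, hp⟩ := Set.Finite.exists_minimal (Set.toFinite {p | f p ≠ 0}) hne
  refine ⟨p, lt_of_le_of_ne (hf.1 p) (Ne.symm hp.1), Finset.sum_eq_zero fun q hq => ?_⟩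
  by_contra hq0
  exact hp.not_lt hq0 (by simpa using hq)

/-- Self-map of the order complex concentrating each point on the elements with less than
mass `δ` strictly below them. -/
noncomputable def concentrate (P : Type*) [PartialOrder P] [Fintype P] (δ : ℝ) (hδ : 0 < δ) :
    C(orderComplex P, orderComplex P) :=
  orderComplexOfWeights
    (fun f p => max 0 (δ - massBelow (f : P → ℝ) p) * (f : P → ℝ) p)
    (by
      refine continuous_pi fun p => ?_
      have hp : Continuous fun f : orderComplex P => (f : P → ℝ) p :=
        (continuous_apply p).comp continuous_subtype_val
      have hm : Continuous fun f : orderComplex P => massBelow (f : P → ℝ) p :=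
        (continuous_massBelow p).comp continuous_subtype_val
      exact (continuous_const.max (continuous_const.sub hm)).mul hp)
    (fun f p => mul_nonneg (le_max_left _ _) (f.2.1 p))
    (fun f => by
      obtain ⟨p, hp, h⟩ := exists_massBelow_eq_zero f.2
      exact ⟨p, mul_pos (by simp [h, hδ]) hp⟩)
    (fun f => f.2.2.2.mono fun p hp => right_ne_zero_of_mul (ne_of_gt hp))

lemma concentrate_ne_zero [Fintype P] {δ : ℝ} {hδ : 0 < δ} {f : orderComplex P} {p : P}
    (h : (concentrate P δ hδ f : P → ℝ) p ≠ 0) :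
    (f : P → ℝ) p ≠ 0 ∧ massBelow (f : P → ℝ) p < δ := by
  have h := pos_of_orderComplexOfWeights_ne_zero h
  refine ⟨right_ne_zero_of_mul h.ne', ?_⟩
  by_contra! h'
  rw [max_eq_left (by linarith)] at h
  simp at h

lemma concentrate_homotopic_id [Fintype P] (δ : ℝ) (hδ : 0 < δ) :
    (concentrate P δ hδ).Homotopic (ContinuousMap.id _) :=
  ContinuousMap.homotopic_of_segment _ _ fun f _ h0 h1 =>
    segment_mem_orderComplex (Subtype.prop _) f.2
      (f.2.2.2.mono fun _ hp => hp.elim (fun h => (concentrate_ne_zero h).1) id) h0 h1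

end OrderComplex

section Height

/-- The number of elements strictly below `x`. -/
noncomputable def relHeight (T : Set (X × X)) (x : X) : ℝ := (lowerSet T x).ncard

lemma relHeight_add_one_le [Finite X] {T : Set (X × X)} (hT : IsOrder T) {a b : X}
    (hab : (a, b) ∈ T) (hne : a ≠ b) : relHeight T a + 1 ≤ relHeight T b := by
  have : lowerSet T a ⊂ lowerSet T b := by
    refine ⟨fun z hz => ⟨hT.2.1 _ _ _ hz.1 hab, ?_⟩, fun h => (h ⟨hab, hne⟩).2 rfl⟩
    rintro rfl
    exact hz.2 (hT.2.2 _ _ hz.1 hab)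
  have := Set.ncard_lt_ncard this (Set.toFinite _)
  unfold relHeight
  exact_mod_cast this

lemma relHeight_nonneg (T : Set (X × X)) (x : X) : 0 ≤ relHeight T x := Nat.cast_nonneg _

lemma relHeight_le_card [Fintype X] (T : Set (X × X)) (x : X) :
    relHeight T x ≤ Fintype.card X := by
  unfold relHeight
  rw [← Nat.card_eq_fintype_card]
  exact_mod_cast Set.ncard_le_card _

end Height

section Compatible

/-- The real functions on `X` that increase by at least one along `R` and increase along some
pair outside `R`. -/
def compatibleMaps (R : Set (X × X)) : Set (X → ℝ) :=
  {v | (∀ a b, (a, b) ∈ R → a ≠ b → 1 ≤ v b - v a) ∧ ∃ a b, (a, b) ∉ R ∧ 0 < v b - v a}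

lemma exists_max_pair [Finite X] {R : Set (X × X)} {v : X → ℝ} (hv : v ∈ compatibleMaps R) :
    ∃ a b, (a, b) ∉ R ∧ 0 < v b - v a ∧ ∀ c d, (c, d) ∉ R → v d - v c ≤ v b - v a := by
  obtain ⟨a, b, hab, hpos⟩ := hv.2
  obtain ⟨⟨c, d⟩, hcd, hmax⟩ := Set.exists_max_image Rᶜ (fun p : X × X => v p.2 - v p.1)
    (Set.toFinite _) ⟨(a, b), hab⟩
  exact ⟨c, d, hcd, hpos.trans_le (hmax _ hab), fun c' d' h => hmax (c', d') h⟩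

lemma exists_eSet_pair [Finite X] {R : Set (X × X)} (hR : IsOrder R) {v : X → ℝ}
    (hv : v ∈ compatibleMaps R) : ∃ a b, (a, b) ∈ eSet R ∧ 0 < v b - v a := by
  obtain ⟨a, b, hab, hpos, hmax⟩ := exists_max_pair hv
  have hne : a ≠ b := fun h => hab (h ▸ hR.1 a)
  have hba : (b, a) ∉ R := fun h => by
    have := hv.1 _ _ h hne.symm
    linarith
  refine ⟨a, b, ⟨fun h => h.elim hab hba, fun c hc => ?_, fun c hc => ?_⟩, hpos⟩
  · refine ⟨?_, fun h => hba (by simpa [h] using hc.1)⟩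
    by_contra h
    have h1 := hmax _ _ h
    have h2 := hv.1 _ _ hc.1 hc.2
    simp only at h1 h2
    linarith
  · refine ⟨?_, fun h => hba (by simpa [← h] using hc.1)⟩
    by_contra h
    have h1 := hmax _ _ h
    have h2 := hv.1 _ _ hc.1 hc.2
    simp only at h1 h2
    linarith

/-- The orders strictly containing `R`. -/
abbrev UpperInterval (R : Set (X × X)) := {T : Set (X × X) // IsOrder T ∧ R ⊂ T}

lemma isOrder_of_increasing (v : X → ℝ) : IsOrder {p : X × X | p.1 = p.2 ∨ v p.1 < v p.2} := by
  refine ⟨fun x => Or.inl rfl, ?_, ?_⟩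
  · rintro x y z (h | h) (h' | h') <;> simp only [Set.mem_ofPred_eq] at h h' ⊢
    · exact Or.inl (h.trans h')
    · exact Or.inr (h ▸ h')
    · exact Or.inr (h' ▸ h)
    · exact Or.inr (h.trans h')
  · rintro x y (h | h) (h' | h')
    · exact h
    · exact h
    · exact h'.symm
    · exact absurd h (lt_asymm h')

open Classical in
/-- The weight of `T` at `v`: it is positive exactly when the increments of `v` along `T`,
truncated at `1/2`, exceed those along the pairs outside `T`, truncated at `0`. -/
noncomputable def thresholdWeight [Fintype X] (v : X → ℝ) (T : Set (X × X)) : ℝ :=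
  ∏ p : X × X, ∏ q : X × X,
    if p ∈ T ∧ p.1 ≠ p.2 ∧ q ∉ T then
      max 0 (min (1 / 2) (v p.2 - v p.1) - max 0 (v q.2 - v q.1))
    else 1

variable [Fintype X] {R : Set (X × X)}

lemma continuous_thresholdWeight (T : Set (X × X)) :
    Continuous fun v : X → ℝ => thresholdWeight v T := by
  unfold thresholdWeight
  refine continuous_finsetProd _ fun p _ => continuous_finsetProd _ fun q _ => ?_
  split_ifs <;> fun_prop

lemma thresholdWeight_nonneg (v : X → ℝ) (T : Set (X × X)) : 0 ≤ thresholdWeight v T := by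
  refine Finset.prod_nonneg fun p _ => Finset.prod_nonneg fun q _ => ?_
  split_ifs <;> simp

lemma thresholdWeight_pos {v : X → ℝ} {T : Set (X × X)} :
    0 < thresholdWeight v T ↔ ∀ a b c d, (a, b) ∈ T → a ≠ b → (c, d) ∉ T →
      max 0 (v d - v c) < min (1 / 2) (v b - v a) := by
  classical
  constructor
  · intro h a b c d hab hne hcd
    have h1 := Finset.prod_ne_zero_iff.1 (Finset.prod_ne_zero_iff.1 h.ne' (a, b)
      (Finset.mem_univ _)) (c, d) (Finset.mem_univ _)
    rw [if_pos ⟨hab, hne, hcd⟩] at h1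
    by_contra! h2
    exact h1 (max_eq_left (by simp only; linarith))
  · intro h
    refine Finset.prod_pos fun p _ => Finset.prod_pos fun q _ => ?_
    split_ifs with hpq
    · exact lt_max_of_lt_right (sub_pos.2 (h _ _ _ _ hpq.1 hpq.2.1 hpq.2.2))
    · exact one_pos

lemma thresholdWeight_pos_of_increasing (v : X → ℝ) :
    0 < thresholdWeight v {p : X × X | p.1 = p.2 ∨ v p.1 < v p.2} := by
  refine thresholdWeight_pos.2 fun a b c d hab hne hcd => ?_
  simp only [Set.mem_ofPred_eq, not_or, not_lt] at hab hcd
  have := hab.resolve_left hne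
  rw [max_eq_left (by linarith [hcd.2])]
  exact lt_min (by norm_num) (by linarith)

/-- An order strictly containing `R` contains the pairs along which `v` increases by at least
`1/2`, provided its weight is positive. -/
lemma mem_of_thresholdWeight_pos {v : X → ℝ} {T : UpperInterval R} (hR : IsOrder R)
    (h : 0 < thresholdWeight v T.1) {a b : X} (hab : 1 / 2 ≤ v b - v a) : (a, b) ∈ T.1 := by
  by_contra h'
  obtain ⟨⟨c, d⟩, hcd, hcR⟩ := Set.exists_of_ssubset T.2.2
  have hne : c ≠ d := fun e => hcR (e ▸ hR.1 c)
  have h1 := thresholdWeight_pos.1 h c d a b hcd hne h'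
  have h2 := (le_max_right 0 (v b - v a)).trans_lt h1
  exact absurd (h2.trans_le (min_le_left _ _)) (by linarith)

lemma isChain_thresholdWeight (v : X → ℝ) :
    IsChain (· ≤ ·) {T : UpperInterval R | 0 < thresholdWeight v T.1} := by
  intro S hS T hT _
  by_contra! h
  obtain ⟨⟨a, b⟩, hab, hab'⟩ := Set.not_subset.1 h.1
  obtain ⟨⟨c, d⟩, hcd, hcd'⟩ := Set.not_subset.1 h.2
  have hne : a ≠ b := fun e => hab' (e ▸ T.2.1.1 a)
  have hne' : c ≠ d := fun e => hcd' (e ▸ S.2.1.1 c)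
  have h1 := thresholdWeight_pos.1 hS a b c d hab hne hcd'
  have h2 := thresholdWeight_pos.1 hT c d a b hcd hne' hab'
  have h3 := (le_max_right _ _).trans_lt (h1.trans_le (min_le_right _ _))
  have h4 := (le_max_right _ _).trans_lt (h2.trans_le (min_le_right _ _))
  exact lt_asymm h3 h4

noncomputable instance : Fintype (UpperInterval R) := Fintype.ofFinite _

/-- The threshold orders of a compatible map, as a point of the order complex. -/
noncomputable def thresholdMap (R : Set (X × X)) :
    C(compatibleMaps R, orderComplex (UpperInterval R)) :=
  orderComplexOfWeights (fun v T => thresholdWeight v.1 T.1)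
    (continuous_pi fun T => (continuous_thresholdWeight T.1).comp continuous_subtype_val)
    (fun _ _ => thresholdWeight_nonneg _ _)
    (fun v => by
      obtain ⟨h1, a, b, hab, hpos⟩ := v.2
      refine ⟨⟨{p | p.1 = p.2 ∨ v.1 p.1 < v.1 p.2}, isOrder_of_increasing _, ?_, fun h => ?_⟩,
        thresholdWeight_pos_of_increasing _⟩
      · rintro ⟨c, d⟩ hcd
        refine or_iff_not_imp_left.2 fun hne => ?_
        have := h1 c d hcd hne
        simp only
        linarith
      · exact hab (h (Or.inr (by simp only; linarith))))
    (fun _ => isChain_thresholdWeight _)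

lemma thresholdWeight_pos_of_thresholdMap_ne_zero {v : compatibleMaps R} {T : UpperInterval R}
    (h : (thresholdMap R v : UpperInterval R → ℝ) T ≠ 0) : 0 < thresholdWeight v.1 T.1 :=
  pos_of_orderComplexOfWeights_ne_zero
    (ψ := fun (v : compatibleMaps R) (T : UpperInterval R) => thresholdWeight v.1 T.1) h

/-- The map from the order complex to functions on `X` that is affine on simplices and sends an
order to its height function. -/
noncomputable def heightCombination (f : UpperInterval R → ℝ) (x : X) : ℝ :=
  ∑ T, f T * relHeight T.1 x

lemma continuous_heightCombination :
    Continuous (heightCombination : (UpperInterval R → ℝ) → X → ℝ) := by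
  unfold heightCombination
  fun_prop

lemma heightCombination_sub (f : UpperInterval R → ℝ) (a b : X) :
    heightCombination f b - heightCombination f a =
      ∑ T, f T * (relHeight T.1 b - relHeight T.1 a) := by
  simp only [heightCombination, ← Finset.sum_sub_distrib, mul_sub]

lemma one_le_heightCombination_sub {f : UpperInterval R → ℝ}
    (hf : f ∈ orderComplex (UpperInterval R)) {a b : X} (hne : a ≠ b)
    (h : ∀ T, f T ≠ 0 → (a, b) ∈ T.1) :
    1 ≤ heightCombination f b - heightCombination f a := by
  rw [heightCombination_sub, ← (mem_orderComplex_iff.1 hf).2.1]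
  refine Finset.sum_le_sum fun T _ => ?_
  by_cases h0 : f T = 0
  · simp [h0]
  · have := relHeight_add_one_le T.2.1 (h T h0) hne
    exact le_mul_of_one_le_right (hf.1 T) (by linarith)

lemma le_heightCombination_sub {f : UpperInterval R → ℝ}
    (hf : f ∈ orderComplex (UpperInterval R)) {S : UpperInterval R} (hS : f S ≠ 0) {a b : X}
    (hne : a ≠ b) (h : (a, b) ∈ S.1) :
    1 - (Fintype.card X + 1) * massBelow f S ≤ heightCombination f b - heightCombination f a := by
  classical
  have hsum := (mem_orderComplex_iff.1 hf).2.1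
  rw [heightCombination_sub, massBelow, Finset.sum_filter, Finset.mul_sum, sub_le_iff_le_add,
    ← Finset.sum_add_distrib, ← hsum]
  refine Finset.sum_le_sum fun T _ => ?_
  have h0 := hf.1 T
  split_ifs with hlt
  · have h1 := relHeight_le_card T.1 a
    have h2 := relHeight_nonneg T.1 b
    nlinarith
  · by_cases hT : f T = 0
    · simp [hT]
    · have hle : S ≤ T := by
        rcases hf.2.2.total hS hT with h | h
        · exact h
        · exact (h.lt_or_eq.resolve_left hlt).ge
      have := relHeight_add_one_le T.2.1 (hle h) hne
      nlinarith

lemma heightCombination_mem (hR : IsOrder R) {f : UpperInterval R → ℝ}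
    (hf : f ∈ orderComplex (UpperInterval R)) : heightCombination f ∈ compatibleMaps R := by
  refine ⟨fun a b hab hne => one_le_heightCombination_sub hf hne fun T _ => T.2.2.1 hab, ?_⟩
  obtain ⟨S, hS, h0⟩ := exists_massBelow_eq_zero hf
  obtain ⟨⟨a, b⟩, hab, hab'⟩ := Set.exists_of_ssubset S.2.2
  have hne : a ≠ b := fun e => hab' (e ▸ hR.1 a)
  have := le_heightCombination_sub hf hS.ne' hne hab
  rw [h0] at this
  exact ⟨a, b, hab', by linarith⟩

/-- `heightCombination` as a continuous map into the compatible maps. -/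
noncomputable def heightMap (hR : IsOrder R) :
    C(orderComplex (UpperInterval R), compatibleMaps R) where
  toFun f := ⟨heightCombination f.1, heightCombination_mem hR f.2⟩
  continuous_toFun := (continuous_heightCombination.comp continuous_subtype_val).subtype_mk _

lemma heightMap_comp_thresholdMap (hR : IsOrder R) :
    ((heightMap hR).comp (thresholdMap R)).Homotopic (ContinuousMap.id _) := by
  refine ContinuousMap.homotopic_of_segment _ _ fun v t h0 h1 => ?_
  have hw : heightCombination (thresholdMap R v).1 ∈ compatibleMaps R :=
    heightCombination_mem hR (thresholdMap R v).2
  change (1 - t) • heightCombination (thresholdMap R v).1 + t • v.1 ∈ _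
  refine ⟨fun a b hab hne => ?_, ?_⟩
  · have h2 := hw.1 a b hab hne
    have h3 := v.2.1 a b hab hne
    simp only [Pi.add_apply, Pi.smul_apply, smul_eq_mul]
    nlinarith
  · obtain ⟨a, b, hab, hpos, hmax⟩ := exists_max_pair v.2
    refine ⟨a, b, hab, ?_⟩
    have hne : a ≠ b := fun e => hab (e ▸ hR.1 a)
    have h2 := one_le_heightCombination_sub (thresholdMap R v).2 hne fun T hT => by
      have hT := thresholdWeight_pos_of_thresholdMap_ne_zero hT
      by_contra h'
      obtain ⟨⟨c, d⟩, hcd, hcR⟩ := Set.exists_of_ssubset T.2.2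
      have hne : c ≠ d := fun e => hcR (e ▸ hR.1 c)
      have h2 := thresholdWeight_pos.1 hT c d a b hcd hne h'
      have h3 := (le_max_right _ _).trans_lt (h2.trans_le (min_le_right _ _))
      exact absurd h3 (hmax c d hcR).not_gt
    simp only [Pi.add_apply, Pi.smul_apply, smul_eq_mul]
    rcases h0.eq_or_lt with rfl | h0
    · linarith
    · nlinarith

lemma thresholdMap_comp_heightMap (hR : IsOrder R) :
    ((thresholdMap R).comp (heightMap hR)).Homotopic (ContinuousMap.id _) := by
  have hN : (0 : ℝ) < 2 * (Fintype.card X + 1) := by positivity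
  refine .trans ?_ (concentrate_homotopic_id (1 / (2 * (Fintype.card X + 1))) (by positivity))
  refine ContinuousMap.homotopic_of_segment _ _ fun f t h0 h1 =>
    segment_mem_orderComplex (Subtype.prop _) (Subtype.prop _) ?_ h0 h1
  have key : ∀ S T : UpperInterval R,
      ((thresholdMap R).comp (heightMap hR) f : UpperInterval R → ℝ) S ≠ 0 →
      (concentrate _ (1 / (2 * (Fintype.card X + 1))) (by positivity) f :
        UpperInterval R → ℝ) T ≠ 0 → T ≤ S := by
    rintro S T hS hT ⟨a, b⟩ hab
    obtain ⟨hT, hm⟩ := concentrate_ne_zero hT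
    by_cases hne : a = b
    · exact hne ▸ S.2.1.1 a
    refine mem_of_thresholdWeight_pos hR (thresholdWeight_pos_of_thresholdMap_ne_zero hS) ?_
    have h2 := le_heightCombination_sub f.2 hT hne hab
    rw [lt_div_iff₀ hN] at hm
    change 1 / 2 ≤ heightCombination f.1 b - heightCombination f.1 a
    linarith
  rintro S (hS | hS) T (hT | hT) hne
  · exact (Subtype.prop ((thresholdMap R).comp (heightMap hR) f)).2.2 hS hT hne
  · exact Or.inr (key S T hS hT)
  · exact Or.inl (key T S hT hS)
  · exact (Subtype.prop (concentrate _ _ _ f)).2.2 hS hT hne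

/-- The order complex of `]R, ·[` is homotopy equivalent to the space of compatible maps. -/
noncomputable def orderComplexHomotopyEquiv (hR : IsOrder R) :
    orderComplex (UpperInterval R) ≃ₕ compatibleMaps R where
  toFun := heightMap hR
  invFun := thresholdMap R
  left_inv := thresholdMap_comp_heightMap hR
  right_inv := heightMap_comp_thresholdMap hR

end Compatible

section Sphere

variable {R : Set (X × X)}

/-- The class of `a` for the relation `Δ ∪ 𝓔_R`. -/
def eClass (R : Set (X × X)) (a : X) : Set X := {b : X | (a, b) ∈ delta X ∪ eSet R}

lemma lowerSet_eq_of_mem_eSet (hsym : eSet R = opRel (eSet R)) {a b : X} (h : (a, b) ∈ eSet R) :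
    lowerSet R a = lowerSet R b := by
  have h' : (b, a) ∈ eSet R := by rw [hsym] at h; exact h
  exact h.2.1.antisymm h'.2.1

lemma upperSet_eq_of_mem_eSet (hsym : eSet R = opRel (eSet R)) {a b : X} (h : (a, b) ∈ eSet R) :
    upperSet R a = upperSet R b := by
  have h' : (b, a) ∈ eSet R := by rw [hsym] at h; exact h
  exact h'.2.2.antisymm h.2.2

lemma mem_eSet_trans (hsym : eSet R = opRel (eSet R)) {a b c : X}
    (hab : (a, b) ∈ eSet R) (hbc : (b, c) ∈ eSet R) (hne : a ≠ c) : (a, c) ∈ eSet R := by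
  have hl := (lowerSet_eq_of_mem_eSet hsym hab).trans (lowerSet_eq_of_mem_eSet hsym hbc)
  have hu := (upperSet_eq_of_mem_eSet hsym hab).trans (upperSet_eq_of_mem_eSet hsym hbc)
  refine ⟨?_, hl.le, hu.ge⟩
  rintro (h | h)
  · have : c ∈ upperSet R a := ⟨h, hne⟩
    exact (hu ▸ this).2 rfl
  · have : c ∈ lowerSet R a := ⟨h, hne.symm⟩
    exact (hl ▸ this).2 rfl

lemma eClass_eq_iff (hsym : eSet R = opRel (eSet R)) {a b : X} :
    eClass R a = eClass R b ↔ a = b ∨ (a, b) ∈ eSet R := by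
  have symm : ∀ {a b}, (a, b) ∈ eSet R → (b, a) ∈ eSet R := fun h => by rw [hsym] at h; exact h
  have sub : ∀ {a b}, (a, b) ∈ eSet R → eClass R b ⊆ eClass R a := by
    rintro a b hab c (h | h)
    · exact Or.inr ((show b = c from h) ▸ hab)
    · by_cases hne : a = c
      · exact Or.inl hne
      · exact Or.inr (mem_eSet_trans hsym hab h hne)
  refine ⟨fun h => ?_, ?_⟩
  · have : b ∈ eClass R b := Or.inl rfl
    rw [← h] at this
    exact this
  · rintro (rfl | h)
    · rfl
    · exact (sub (symm h)).antisymm (sub h)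

/-- A chosen representative of the class of `x`. -/
noncomputable def eRep (R : Set (X × X)) (x : X) : X :=
  Set.rangeSplitting (eClass R) ⟨eClass R x, x, rfl⟩

lemma eClass_eRep (x : X) : eClass R (eRep R x) = eClass R x :=
  Set.apply_rangeSplitting (eClass R) _

lemma eRep_eq {x y : X} (h : eClass R x = eClass R y) : eRep R x = eRep R y := by
  unfold eRep
  congr 2

/-- The elements that are not the chosen representative of their class. -/
def nonRep (R : Set (X × X)) : Set X := {x | eRep R x ≠ x}

lemma eRep_notMem_nonRep (x : X) : eRep R x ∉ nonRep R := fun h => h (eRep_eq (eClass_eRep x))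

lemma ncard_nonRep [Fintype X] :
    (nonRep R).ncard = Fintype.card X - (Set.range (eClass R)).ncard := by
  have h : (nonRep R)ᶜ = Set.range (Set.rangeSplitting (eClass R)) := by
    ext x
    simp only [nonRep, Set.mem_compl_iff, Set.mem_ofPred_eq, not_not]
    refine ⟨fun h => ⟨_, h⟩, ?_⟩
    rintro ⟨y, rfl⟩
    unfold eRep
    congr 1
    exact Subtype.ext (Set.apply_rangeSplitting (eClass R) y)
  have h1 := Set.ncard_add_ncard_compl (nonRep R)
  rw [h, ← Set.image_univ, Set.ncard_image_of_injective _ (Set.rangeSplitting_injective _),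
    Set.ncard_univ, Nat.card_coe_set_eq, Nat.card_eq_fintype_card] at h1
  omega

variable {m : ℕ} (e : nonRep R ≃ Fin m)

/-- Increments of a function relative to the representatives of the classes. -/
noncomputable def increments (v : X → ℝ) : EuclideanSpace ℝ (Fin m) :=
  WithLp.toLp 2 fun i => v (e.symm i) - v (eRep R (e.symm i))

open Classical in
/-- The function vanishing at the representatives with the given other values. -/
noncomputable def extendZero (u : EuclideanSpace ℝ (Fin m)) (x : X) : ℝ :=
  if h : x ∈ nonRep R then u (e ⟨x, h⟩) else 0

lemma continuous_increments : Continuous (increments e) := by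
  unfold increments
  fun_prop

lemma continuous_extendZero : Continuous (extendZero e) := by
  refine continuous_pi fun x => ?_
  unfold extendZero
  split_ifs <;> fun_prop

lemma extendZero_smul (c : ℝ) (u : EuclideanSpace ℝ (Fin m)) (x : X) :
    extendZero e (c • u) x = c * extendZero e u x := by
  unfold extendZero
  split_ifs <;> simp

lemma extendZero_eRep (u : EuclideanSpace ℝ (Fin m)) (x : X) : extendZero e u (eRep R x) = 0 :=
  dif_neg (eRep_notMem_nonRep x)

lemma extendZero_symm (u : EuclideanSpace ℝ (Fin m)) (i : Fin m) :
    extendZero e u (e.symm i) = u i := by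
  simp [extendZero]

lemma abs_extendZero_le (u : EuclideanSpace ℝ (Fin m)) (x : X) : |extendZero e u x| ≤ ‖u‖ := by
  unfold extendZero
  split_ifs
  · exact PiLp.norm_apply_le u _
  · simp

lemma extendZero_increments (v : X → ℝ) (x : X) :
    extendZero e (increments e v) x = v x - v (eRep R x) := by
  unfold extendZero
  split_ifs with h
  · simp [increments]
  · rw [show eRep R x = x from not_not.1 h, sub_self]

lemma extendZero_increments_sub (v : X → ℝ) {a b : X} (h : eClass R a = eClass R b) :
    extendZero e (increments e v) b - extendZero e (increments e v) a = v b - v a := by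
  rw [extendZero_increments, extendZero_increments, eRep_eq h]
  ring

lemma relHeight_eq (hsym : eSet R = opRel (eSet R)) {a b : X}
    (h : eClass R a = eClass R b) : relHeight R a = relHeight R b := by
  rcases (eClass_eq_iff hsym).1 h with rfl | h
  · rfl
  · rw [relHeight, lowerSet_eq_of_mem_eSet hsym h, relHeight]

lemma increments_ne_zero [Finite X] (hR : IsOrder R) (hsym : eSet R = opRel (eSet R))
    {v : X → ℝ} (hv : v ∈ compatibleMaps R) : increments e v ≠ 0 := by
  intro h0
  obtain ⟨a, b, hab, hpos⟩ := exists_eSet_pair hR hv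
  rw [← extendZero_increments_sub e v ((eClass_eq_iff hsym).2 (Or.inr hab)), h0] at hpos
  simp [extendZero] at hpos

lemma extendZero_add_relHeight_mem [Finite X] (hR : IsOrder R)
    (hsym : eSet R = opRel (eSet R)) {u : EuclideanSpace ℝ (Fin m)} (hu : ‖u‖ = 1) :
    (fun x => extendZero e u x + 3 * relHeight R x) ∈ compatibleMaps R := by
  refine ⟨fun a b hab hne => ?_, ?_⟩
  · have h1 := abs_le.1 (abs_extendZero_le e u a)
    have h2 := abs_le.1 (abs_extendZero_le e u b)
    have h3 := relHeight_add_one_le hR hab hne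
    simp only
    linarith
  · obtain ⟨i, hi⟩ : ∃ i, u i ≠ 0 := by
      by_contra! h
      have : u = 0 := by ext i; exact h i
      simp [this] at hu
    set x : X := (e.symm i : X)
    have hux : extendZero e u x = u i := extendZero_symm e u i
    have hur : extendZero e u (eRep R x) = 0 := extendZero_eRep e u x
    have hh : relHeight R (eRep R x) = relHeight R x := relHeight_eq hsym (eClass_eRep x)
    have hE : (eRep R x, x) ∈ eSet R :=
      ((eClass_eq_iff hsym).1 (eClass_eRep x)).resolve_left (e.symm i).2
    rcases hi.lt_or_gt with hi | hi
    · refine ⟨x, eRep R x, fun h => hE.1 (Or.inr h), ?_⟩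
      simp only [hux, hur, hh]
      linarith
    · refine ⟨eRep R x, x, fun h => hE.1 (Or.inl h), ?_⟩
      simp only [hux, hur, hh]
      linarith

/-- The direction of the increments of a compatible map. -/
noncomputable def directionMap [Finite X] (hR : IsOrder R) (hsym : eSet R = opRel (eSet R)) :
    C(compatibleMaps R, Metric.sphere (0 : EuclideanSpace ℝ (Fin m)) 1) where
  toFun v := ⟨‖increments e v.1‖⁻¹ • increments e v.1, by
    have := increments_ne_zero e hR hsym v.2
    simp [norm_smul, this]⟩
  continuous_toFun := by
    have h := (continuous_increments e).comp (continuous_subtype_val (p := (· ∈ compatibleMaps R)))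
    refine Continuous.subtype_mk (Continuous.smul (h.norm.inv₀ fun v => ?_) h) _
    exact norm_ne_zero_iff.2 (increments_ne_zero e hR hsym v.2)

/-- The compatible map with a given direction. -/
noncomputable def ofDirectionMap [Finite X] (hR : IsOrder R) (hsym : eSet R = opRel (eSet R)) :
    C(Metric.sphere (0 : EuclideanSpace ℝ (Fin m)) 1, compatibleMaps R) where
  toFun u := ⟨fun x => extendZero e u.1 x + 3 * relHeight R x,
    extendZero_add_relHeight_mem e hR hsym (by simp)⟩
  continuous_toFun := by
    refine Continuous.subtype_mk (continuous_pi fun x => ?_) _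
    exact (((continuous_apply x).comp (continuous_extendZero e)).comp
      continuous_subtype_val).add continuous_const

lemma directionMap_comp_ofDirectionMap [Finite X] (hR : IsOrder R)
    (hsym : eSet R = opRel (eSet R)) :
    (directionMap e hR hsym).comp (ofDirectionMap e hR hsym) = ContinuousMap.id _ := by
  ext1 u
  have h : increments e (ofDirectionMap e hR hsym u).1 = u.1 := by
    ext i
    simp only [increments, ofDirectionMap, ContinuousMap.coe_mk, extendZero_symm, extendZero_eRep,
      relHeight_eq hsym (eClass_eRep _)]
    ring
  have hu : ‖u.1‖ = 1 := by simp
  apply Subtype.ext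
  simp [directionMap, h, hu]

lemma ofDirectionMap_comp_directionMap [Finite X] (hR : IsOrder R)
    (hsym : eSet R = opRel (eSet R)) :
    ((ofDirectionMap e hR hsym).comp (directionMap e hR hsym)).Homotopic
      (ContinuousMap.id _) := by
  refine ContinuousMap.homotopic_of_segment _ _ fun v t h0 h1 => ?_
  have hw := (ofDirectionMap e hR hsym (directionMap e hR hsym v)).2
  have hd : ∀ x, (ofDirectionMap e hR hsym (directionMap e hR hsym v)).1 x =
      ‖increments e v.1‖⁻¹ * extendZero e (increments e v.1) x + 3 * relHeight R x :=
    fun x => by rw [← extendZero_smul]; rfl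
  simp only [ContinuousMap.comp_apply, ContinuousMap.id_apply]
  refine ⟨fun a b hab hne => ?_, ?_⟩
  · have h2 := hw.1 a b hab hne
    have h3 := v.2.1 a b hab hne
    simp only [Pi.add_apply, Pi.smul_apply, smul_eq_mul]
    nlinarith
  · obtain ⟨a, b, hab, hpos⟩ := exists_eSet_pair hR v.2
    have hc : eClass R a = eClass R b := (eClass_eq_iff hsym).2 (Or.inr hab)
    refine ⟨a, b, fun h => hab.1 (Or.inl h), ?_⟩
    have hn : 0 < ‖increments e v.1‖⁻¹ :=
      inv_pos.2 (norm_pos_iff.2 (increments_ne_zero e hR hsym v.2))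
    simp only [Pi.add_apply, Pi.smul_apply, smul_eq_mul, hd, relHeight_eq hsym hc]
    have h2 := extendZero_increments_sub e v.1 hc
    have h3 : 0 < ((1 - t) * ‖increments e v.1‖⁻¹ + t) * (v.1 b - v.1 a) := by
      refine mul_pos ?_ hpos
      rcases h0.eq_or_lt with rfl | h0
      · simpa using hn
      · have : 0 ≤ (1 - t) * ‖increments e v.1‖⁻¹ := mul_nonneg (by linarith) hn.le
        linarith
    have h4 : extendZero e (increments e v.1) b =
      extendZero e (increments e v.1) a + (v.1 b - v.1 a) := by linarith
    rw [h4]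
    linarith

/-- The space of compatible maps is homotopy equivalent to a sphere. -/
noncomputable def compatibleMapsHomotopyEquiv [Finite X] (hR : IsOrder R)
    (hsym : eSet R = opRel (eSet R)) :
    compatibleMaps R ≃ₕ Metric.sphere (0 : EuclideanSpace ℝ (Fin m)) 1 where
  toFun := directionMap e hR hsym
  invFun := ofDirectionMap e hR hsym
  left_inv := ofDirectionMap_comp_directionMap e hR hsym
  right_inv := by rw [directionMap_comp_ofDirectionMap]

end Sphere

/-- Corollary 5.5(2): if `𝓔_R = (𝓔_R)^op`, so that `E_R = Δ ∪ 𝓔_R` is an equivalence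
relation with `r` classes, and `r < n = |X|`, then `]R, ·[` has the homotopy type of a
sphere of dimension `n − r − 1`. -/
theorem upperInterval_homotopyEquiv_sphere {X : Type*} [Fintype X]
    (R : Set (X × X)) (hR : IsOrder R) (hsym : eSet R = opRel (eSet R))
    (n r : ℕ) (hn : n = Fintype.card X)
    (hr : r = Set.ncard {C : Set X | ∃ a : X, C = {b : X | (a, b) ∈ delta X ∪ eSet R}})
    (hrn : r < n) :
    Nonempty ((orderComplex {T : Set (X × X) // IsOrder T ∧ R ⊂ T}) ≃ₕ
      (Metric.sphere (0 : EuclideanSpace ℝ (Fin (n - r))) 1)) := by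
  have hrange : {C : Set X | ∃ a : X, C = {b : X | (a, b) ∈ delta X ∪ eSet R}} =
      Set.range (eClass R) := by
    ext C
    simp only [Set.mem_ofPred_eq, Set.mem_range, eClass, eq_comm]
  have hcard : Nat.card (nonRep R) = n - r := by
    rw [Nat.card_coe_set_eq, ncard_nonRep, hn, hr, hrange]
  exact ⟨(orderComplexHomotopyEquiv hR).trans
    (compatibleMapsHomotopyEquiv (Finite.equivFinOfCardEq hcard) hR hsym)⟩
end

section
/- Let R be an order on the finite set X such that there is no chain x <_R y <_R z in X. Set R_− = {x ∈ X : ∃y, x <_R y} and R_+ = {y ∈ X : ∃x, x <_R y}. Then R ∪ (R_− × R_+) is an order on X. -/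
open scoped BigOperators ContinuousMap

variable {X : Type*}

/-- From the proof of Theorem 5.4: if an order `R` has no chain `x <_R y <_R z`, then
`R ∪ (R_− × R_+)` is an order on `X`. -/
theorem union_prod_isOrder {X : Type*} [Fintype X]
    (R : Set (X × X)) (hR : IsOrder R)
    (hchain : ¬ ∃ x y z : X, ((x, y) ∈ R ∧ x ≠ y) ∧ ((y, z) ∈ R ∧ y ≠ z)) :
    IsOrder (R ∪ ({x : X | ∃ y : X, (x, y) ∈ R ∧ x ≠ y} ×ˢ
      {y : X | ∃ x : X, (x, y) ∈ R ∧ x ≠ y})) := by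
  obtain ⟨hrefl, -, -⟩ := hR
  set A : Set X := {x : X | ∃ y : X, (x, y) ∈ R ∧ x ≠ y}
  set B : Set X := {y : X | ∃ x : X, (x, y) ∈ R ∧ x ≠ y}
  have hdisj : ∀ x, x ∈ A → x ∈ B → False := by
    rintro y ⟨z, hyz⟩ ⟨x, hxy⟩
    exact hchain ⟨x, y, z, hxy, hyz⟩
  have hmem : ∀ x y, (x, y) ∈ R ∪ A ×ˢ B ↔ x = y ∨ (x ∈ A ∧ y ∈ B) := by
    intro x y
    constructor
    · rintro (h | h)
      · by_cases hxy : x = y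
        · exact Or.inl hxy
        · exact Or.inr ⟨⟨y, h, hxy⟩, ⟨x, h, hxy⟩⟩
      · exact Or.inr h
    · rintro (rfl | h)
      · exact Or.inl (hrefl x)
      · exact Or.inr h
  refine ⟨fun x => (hmem x x).2 (Or.inl rfl), fun x y z hxy hyz => ?_, fun x y hxy hyx => ?_⟩
  · rcases (hmem x y).1 hxy with rfl | ⟨-, hy⟩
    · exact hyz
    · rcases (hmem y z).1 hyz with rfl | ⟨hy', -⟩
      · exact hxy
      · exact (hdisj y hy' hy).elim
  · rcases (hmem x y).1 hxy with h | ⟨hx, -⟩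
    · exact h
    · rcases (hmem y x).1 hyx with h | ⟨-, hx'⟩
      · exact h.symm
      · exact (hdisj x hx hx').elim
end

section
/- Let R be an order on the finite set X, let (a,b) be a minimal element of (X × X) − (R ∪ R^op) for the relation R^(2), and let T be an order on X with R ⊆ T. Then the transitive closure of R ∪ {(a,b)} ∪ T is antisymmetric if and only if (b,a) ∉ T. -/
open scoped BigOperators ContinuousMap

variable {X : Type*}

/-- Adjoining one pair `(a, b)` to a preorder `T` relates, in the transitive closure, only pairs
of `T` and pairs factoring through `(a, b)`. -/
theorem mem_of_mem_transClosure_insert {X : Type*} {R T : Set (X × X)} (hT : IsOrder T)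
    (hRT : R ⊆ T) {a b x y : X} (h : (x, y) ∈ transClosure (R ∪ {(a, b)} ∪ T)) :
    (x, y) ∈ T ∨ ((x, a) ∈ T ∧ (b, y) ∈ T) := by
  obtain ⟨hrefl, htrans, -⟩ := hT
  have step : ∀ u v : X, (u, v) ∈ R ∪ {(a, b)} ∪ T → (u, v) ∈ T ∨ (u = a ∧ v = b) := by
    rintro u v ((h | h) | h)
    · exact Or.inl (hRT h)
    · exact Or.inr (by simpa using h)
    · exact Or.inl h
  change Relation.TransGen _ x y at h
  induction h with
  | single h =>
    rcases step _ _ h with h | ⟨rfl, rfl⟩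
    · exact Or.inl h
    · exact Or.inr ⟨hrefl _, hrefl _⟩
  | tail _ h ih =>
    rcases step _ _ h with h | ⟨rfl, rfl⟩
    · exact ih.imp (fun k => htrans _ _ _ k h) (fun k => ⟨k.1, htrans _ _ _ k.2 h⟩)
    · exact Or.inr ⟨ih.elim id And.left, hrefl _⟩

/-- From the proof of Theorem 5.3: for `(a, b)` a minimal element of
`(X × X) − (R ∪ R^op)` for `R^(2)` and `T` an order containing `R`, the transitive
closure of `R ∪ {(a, b)} ∪ T` is antisymmetric iff `(b, a) ∉ T`. -/
theorem transClosure_antisymm_iff {X : Type*} [Fintype X]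
    (R T : Set (X × X)) (hR : IsOrder R) (hT : IsOrder T) (hRT : R ⊆ T)
    (a b : X) (hmin : MinimalPair R (a, b)) :
    (∀ x y : X, (x, y) ∈ transClosure (R ∪ {(a, b)} ∪ T) →
      (y, x) ∈ transClosure (R ∪ {(a, b)} ∪ T) → x = y) ↔ (b, a) ∉ T := by
  constructor
  · intro h hba
    have hab : a = b := h a b (.single (Or.inl (Or.inr rfl))) (.single (Or.inr hba))
    subst hab
    exact hmin.1 (Or.inl (hR.1 a))
  · intro hba x y hxy hyx
    have htrans := hT.2.1
    rcases mem_of_mem_transClosure_insert hT hRT hxy with h | ⟨hxa, hby⟩ <;>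
      rcases mem_of_mem_transClosure_insert hT hRT hyx with k | ⟨hya, hbx⟩
    · exact hT.2.2 _ _ h k
    · exact absurd (htrans _ _ _ hbx (htrans _ _ _ h hya)) hba
    · exact absurd (htrans _ _ _ hby (htrans _ _ _ k hxa)) hba
    · exact absurd (htrans _ _ _ hbx hxa) hba
end
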